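/- For every a > 0 and every x > 0, one has h(x) > 0 if a > 1, h(x) = 0 if a = 1, and h(x) < 0 if 0 < a < 1. -/

import Mathlib

open MeasureTheory intervalIntegral

/-- `φ(x) = exp(-x²)`. -/
noncomputable def phi (x : ℝ) : ℝ := Real.exp (-x ^ 2)

/-- `Φ(x) = ∫₀ˣ φ(u) du`. -/
noncomputable def Phi (x : ℝ) : ℝ := ∫ u in (0 : ℝ)..x, phi u

/-- `φ'(x) = -2x·exp(-x²)`, the derivative of `φ`. -/
noncomputable def phi' (x : ℝ) : ℝ := -2 * x * Real.exp (-x ^ 2)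

/-- `f(x) = (φ(ax) - φ(x)) / (x·(Φ(ax) + Φ(x)))`. -/
noncomputable def f (a x : ℝ) : ℝ :=
  (phi (a * x) - phi x) / (x * (Phi (a * x) + Phi x))

/-- `h(x) = (axφ'(ax) - xφ'(x))(Φ(ax)+Φ(x)) - (φ(ax)-φ(x))(Φ(ax)+Φ(x))
      - (φ(ax)-φ(x))(axφ(ax)+xφ(x))`. -/
noncomputable def h (a x : ℝ) : ℝ :=
  (a * x * phi' (a * x) - x * phi' x) * (Phi (a * x) + Phi x)
    - (phi (a * x) - phi x) * (Phi (a * x) + Phi x)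
    - (phi (a * x) - phi x) * (a * x * phi (a * x) + x * phi x)

theorem phi_pos (u : ℝ) : 0 < phi u := Real.exp_pos _

theorem continuous_phi : Continuous phi := by
  unfold phi
  fun_prop

theorem hasDerivAt_phi (u : ℝ) : HasDerivAt phi (phi' u) u := by
  have h₁ : HasDerivAt (fun v : ℝ => -v ^ 2) (-(2 * u)) u := by
    simpa using (hasDerivAt_pow 2 u).fun_neg
  have h₂ := h₁.exp
  unfold phi phi'
  convert h₂ using 1
  ring

theorem hasDerivAt_Phi (u : ℝ) : HasDerivAt Phi (phi u) u :=
  integral_hasDerivAt_right (continuous_phi.intervalIntegrable _ _)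
    continuous_phi.stronglyMeasurable.stronglyMeasurableAtFilter continuous_phi.continuousAt

theorem Phi_nonneg {u : ℝ} (hu : 0 ≤ u) : 0 ≤ Phi u :=
  integral_nonneg hu fun v _ => (phi_pos v).le

theorem one_add_sq_mul_phi_le_one (u : ℝ) : (1 + u ^ 2) * phi u ≤ 1 := by
  have h₁ : u ^ 2 + 1 ≤ Real.exp (u ^ 2) := Real.add_one_le_exp _
  have h₂ : Real.exp (u ^ 2) * phi u = 1 := by
    rw [phi, ← Real.exp_add]
    simp
  nlinarith [phi_pos u]

theorem Phi_le {u : ℝ} (hu : 0 ≤ u) : Phi u ≤ u * (2 + phi u) / 3 := by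
  have hd (v : ℝ) : HasDerivAt (fun w => w * (2 + phi w) / 3 - Phi w)
      ((1 * (2 + phi v) + v * phi' v) / 3 - phi v) v :=
    (((hasDerivAt_id v).mul ((hasDerivAt_phi v).const_add 2)).div_const 3).sub (hasDerivAt_Phi v)
  have hm : Monotone fun w => w * (2 + phi w) / 3 - Phi w := by
    refine monotone_of_deriv_nonneg (fun v => (hd v).differentiableAt) fun v => ?_
    rw [(hd v).deriv]
    have h₁ := one_add_sq_mul_phi_le_one v
    have h₂ : v * phi' v = -2 * v ^ 2 * phi v := by
      unfold phi' phi
      ring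
    rw [h₂]
    linarith
  have h₀ := hm hu
  simp only [Phi, integral_same, zero_mul, zero_div, sub_zero] at h₀
  simp only [Phi]
  linarith

/-- An elementary inequality on `A = exp s` and `C = exp r`. -/
theorem mul_lt_three_mul_sub_one {s r A C : ℝ} (hs : 0 ≤ s) (hr : 0 < r) (hA : A * (1 - s) ≤ 1)
    (hC : 1 + r + r ^ 2 / 2 ≤ C) (hM : 0 < 2 * r - (1 + 2 * s) * (C - 1)) :
    (2 * r - (1 + 2 * s) * (C - 1)) * (2 * (A * C) + 1) < 3 * (C - 1) := by
  have hC₁ : r < C - 1 := by nlinarith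
  have hs₁ : s < 1 / 2 := by nlinarith
  have h₀ : (2 * r - (C - 1)) * (2 * C + 1) < 3 * (C - 1) := by
    nlinarith [mul_nonneg (sub_nonneg.2 hC) (sub_nonneg.2 hC), mul_nonneg (sub_nonneg.2 hC) hr.le,
      mul_nonneg (sub_nonneg.2 hC) (sq_nonneg r), pow_pos hr 2, pow_pos hr 4]
  have h₁ : (2 * r - (1 + 2 * s) * (C - 1)) * (2 * C + (1 - s)) < 3 * (C - 1) * (1 - s) := by
    have h₂ : 0 ≤ s * (2 * r - (1 + 2 * s) * (C - 1)) := mul_nonneg hs hM.le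
    have h₃ : 0 ≤ s * (C - 1) := mul_nonneg hs (by linarith)
    have h₄ : 0 ≤ s * (C - 1) * (C - 1) := mul_nonneg h₃ (by linarith)
    nlinarith
  have h₂ : (2 * r - (1 + 2 * s) * (C - 1)) * (2 * (A * C) + 1) * (1 - s)
      < 3 * (C - 1) * (1 - s) := by
    refine lt_of_le_of_lt ?_ h₁
    rw [mul_assoc]
    refine mul_le_mul_of_nonneg_left ?_ hM.le
    nlinarith
  exact lt_of_mul_lt_mul_right h₂ (by linarith)

theorem sub_mul_two_add_phi_lt {x y : ℝ} (hx : 0 < x) (hxy : x < y)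
    (hG : 0 < (1 + 2 * y ^ 2) * phi y - (1 + 2 * x ^ 2) * phi x) :
    ((1 + 2 * y ^ 2) * phi y - (1 + 2 * x ^ 2) * phi x) * (2 + phi y)
      < 3 * (phi x - phi y) * phi y := by
  have hr : 0 < y ^ 2 - x ^ 2 := by nlinarith
  have hC := Real.quadratic_le_exp_of_nonneg hr.le
  have hA : Real.exp (x ^ 2) * (1 - x ^ 2) ≤ 1 := by
    have h₁ := Real.add_one_le_exp (-x ^ 2)
    have h₂ : Real.exp (x ^ 2) * Real.exp (-x ^ 2) = 1 := by
      rw [← Real.exp_add]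
      simp
    nlinarith [Real.exp_pos (x ^ 2)]
  have hp : phi x = Real.exp (y ^ 2 - x ^ 2) * phi y := by
    rw [phi, phi, ← Real.exp_add]
    ring_nf
  have hq : Real.exp (x ^ 2) * Real.exp (y ^ 2 - x ^ 2) * phi y = 1 := by
    rw [phi, ← Real.exp_add, ← Real.exp_add]
    simp
  have hq₀ := phi_pos y
  generalize Real.exp (y ^ 2 - x ^ 2) = C at *
  generalize Real.exp (x ^ 2) = A at *
  have hGM : (1 + 2 * y ^ 2) * phi y - (1 + 2 * x ^ 2) * phi x
      = (2 * (y ^ 2 - x ^ 2) - (1 + 2 * x ^ 2) * (C - 1)) * phi y := by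
    rw [hp]
    ring
  rw [hGM] at hG ⊢
  have hM := pos_of_mul_pos_left hG hq₀.le
  have key := mul_lt_three_mul_sub_one (sq_nonneg x) hr hA hC hM
  have h₁ : 2 + phi y = (2 * (A * C) + 1) * phi y := by linear_combination (-2) * hq
  rw [h₁, hp]
  have h₂ := mul_lt_mul_of_pos_right key (mul_pos hq₀ hq₀)
  linarith

theorem bracket_pos {x y : ℝ} (hx : 0 < x) (hxy : x < y) :
    0 < (y * phi' y - x * phi' x) * (Phi y + Phi x) - (phi y - phi x) * (Phi y + Phi x)
      - (phi y - phi x) * (y * phi y + x * phi x) := by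
  have hy : 0 < y := hx.trans hxy
  have hp := phi_pos x
  have hq := phi_pos y
  have hpq : phi y < phi x := Real.exp_lt_exp.2 (by nlinarith)
  have hS : 0 ≤ Phi y + Phi x := add_nonneg (Phi_nonneg hy.le) (Phi_nonneg hx.le)
  have e (u : ℝ) : u * phi' u = -2 * u ^ 2 * phi u := by
    unfold phi' phi
    ring
  have hT : 0 < (phi x - phi y) * (y * phi y + x * phi x) :=
    mul_pos (sub_pos.2 hpq) (by positivity)
  rw [e, e]
  set G := (1 + 2 * y ^ 2) * phi y - (1 + 2 * x ^ 2) * phi x with hGdef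
  suffices G * (Phi y + Phi x) < (phi x - phi y) * (y * phi y + x * phi x) by
    rw [hGdef] at this
    linarith
  rcases le_or_gt G 0 with hG | hG
  · exact lt_of_le_of_lt (mul_nonpos_of_nonpos_of_nonneg hG hS) hT
  · have h₁ : G * (2 + phi y) < 3 * (phi x - phi y) * phi y := sub_mul_two_add_phi_lt hx hxy hG
    have h₃ : G < 3 * (phi x - phi y) := by
      by_contra! hc
      nlinarith [mul_le_mul_of_nonneg_right hc hq.le]
    have h₂ : G * (2 + phi x) < 3 * (phi x - phi y) * phi x := by
      nlinarith [mul_pos (sub_pos.2 h₃) (sub_pos.2 hpq)]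
    have h₄ := mul_le_mul_of_nonneg_left (add_le_add (Phi_le hy.le) (Phi_le hx.le)) hG.le
    have h₅ := mul_lt_mul_of_pos_left h₁ hy
    have h₆ := mul_lt_mul_of_pos_left h₂ hx
    linarith

theorem statement_14 (a x : ℝ) (ha : 0 < a) (hx : 0 < x) :
    (1 < a → 0 < h a x) ∧ (a = 1 → h a x = 0) ∧ (a < 1 → h a x < 0) := by
  refine ⟨fun h₁ => bracket_pos hx (by nlinarith), ?_, fun h₁ => ?_⟩
  · rintro rfl
    simp [h]
  · have := bracket_pos (mul_pos ha hx) (show a * x < x by nlinarith)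
    unfold h
    linarith
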